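/- The Barbilian logarithmic oscillation satisfies the triangle inequality: for all A, B, C ∈ J, log(M(A,C)/m(A,C)) ≤ log(M(A,B)/m(A,B)) + log(M(B,C)/m(B,C)). -/

import Mathlib

theorem barbilian_triangle {K : Type*} [TopologicalSpace K] [CompactSpace K] [Nonempty K]
    {J : Type*} (f : K → J → ℝ)
    (hpos : ∀ P A, 0 < f P A)
    (hcont : ∀ A, Continuous fun P => f P A)
    (M m : J → J → ℝ)
    (hM : ∀ A B, IsGreatest (Set.range fun P => f P A / f P B) (M A B))
    (hm : ∀ A B, IsLeast (Set.range fun P => f P A / f P B) (m A B)) :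
    ∀ A B C : J, Real.log (M A C / m A C) ≤
      Real.log (M A B / m A B) + Real.log (M B C / m B C) := by
  intro A B C
  have hmul : ∀ P, f P A / f P C = (f P A / f P B) * (f P B / f P C) := by
    intro P
    have h1 := (hpos P B).ne'
    have h2 := (hpos P C).ne'
    field_simp
  have mpos : ∀ X Y, 0 < m X Y := by
    intro X Y
    obtain ⟨P, hP⟩ := (hm X Y).1
    rw [← hP]
    exact div_pos (hpos P X) (hpos P Y)
  have Mpos : ∀ X Y, 0 < M X Y := by
    intro X Y
    obtain ⟨P, hP⟩ := (hM X Y).1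
    rw [← hP]
    exact div_pos (hpos P X) (hpos P Y)
  have hMM : M A C ≤ M A B * M B C := by
    obtain ⟨P, hP⟩ := (hM A C).1
    rw [← hP]
    change f P A / f P C ≤ _
    rw [hmul P]
    exact mul_le_mul ((hM A B).2 ⟨P, rfl⟩) ((hM B C).2 ⟨P, rfl⟩)
      (div_pos (hpos P B) (hpos P C)).le (Mpos A B).le
  have hmm : m A B * m B C ≤ m A C := by
    obtain ⟨P, hP⟩ := (hm A C).1
    rw [← hP]
    change _ ≤ f P A / f P C
    rw [hmul P]
    exact mul_le_mul ((hm A B).2 ⟨P, rfl⟩) ((hm B C).2 ⟨P, rfl⟩)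
      (mpos B C).le (div_pos (hpos P A) (hpos P B)).le
  rw [← Real.log_mul (div_pos (Mpos A B) (mpos A B)).ne' (div_pos (Mpos B C) (mpos B C)).ne',
    div_mul_div_comm]
  apply Real.log_le_log (div_pos (Mpos A C) (mpos A C))
  exact div_le_div₀ (mul_pos (Mpos A B) (Mpos B C)).le hMM (mul_pos (mpos A B) (mpos B C)) hmm
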